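/- Let X ∈ L¹(ℝ³; ℝ³), let w(x) = (1/4π)∫ ⟨(x-y)/|x-y|³, X(y)⟩ dy, and let X̄ = (1/4π)∫ X(y) dy ∈ ℝ³. Then for every fixed 1 ≤ q < 3/2, (1/|An(R)|) ∫_{An(R)} | R² ( w(x) - ⟨x, X̄⟩/|x|³ ) |^q dx → 0 as R → ∞, where An(R) = {R/8 ≤ |x| ≤ 8R}. -/

import Mathlib

open MeasureTheory Real RealInnerProductSpace Filter

noncomputable section

local notation "E" => EuclideanSpace ℝ (Fin 3)

/-- The annulus with inner radius `R/8` and outer radius `8R`. -/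
def An (R : ℝ) : Set (EuclideanSpace ℝ (Fin 3)) :=
  {x | R / 8 ≤ ‖x‖ ∧ ‖x‖ ≤ 8 * R}

open scoped ENNReal Topology

/-- The dipole kernel. -/
def dK (v : E) : E := (‖v‖ ^ 3)⁻¹ • v

lemma dK_meas : Measurable dK := by
  unfold dK
  fun_prop

lemma dK_norm (v : E) : ‖dK v‖ = (‖v‖ ^ 2)⁻¹ := by
  unfold dK
  rw [norm_smul, norm_inv, norm_pow, norm_norm]
  by_cases h : ‖v‖ = 0
  · simp [h]
  · field_simp

lemma dK_smul {R : ℝ} (hR : 0 < R) (v : E) : R ^ 2 • dK (R • v) = dK v := by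
  unfold dK
  rw [norm_smul, Real.norm_of_nonneg hR.le, smul_smul, smul_smul]
  congr 1
  by_cases h : ‖v‖ = 0
  · simp [h]
  · field_simp

lemma dK_contAt {v : E} (hv : v ≠ 0) : ContinuousAt dK v := by
  unfold dK
  have h1 : ContinuousAt (fun v : E => ‖v‖ ^ 3) v := by fun_prop
  exact (h1.inv₀ (by simpa using hv)).smul continuousAt_id

lemma dK_enorm_le {v : E} {c : ℝ} (hc : 0 < c) (hv : c ≤ ‖v‖) :
    ‖dK v‖ₑ ≤ ENNReal.ofReal ((c ^ 2)⁻¹) := by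
  rw [← ofReal_norm, dK_norm]
  apply ENNReal.ofReal_le_ofReal
  gcongr

lemma An_meas (R : ℝ) : MeasurableSet (An R) := by
  have : IsClosed (An R) :=
    (isClosed_le continuous_const continuous_norm).inter
      (isClosed_le continuous_norm continuous_const)
  exact this.measurableSet

lemma An_vol (R : ℝ) : volume (An R) < ∞ := by
  refine lt_of_le_of_lt (measure_mono (t := Metric.closedBall 0 (8 * R)) ?_)
    measure_closedBall_lt_top
  intro x hx
  simpa using hx.2

open scoped Pointwise in
lemma An_smul {R : ℝ} (hR : 0 < R) : An R = R • An 1 := by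
  ext x
  rw [Set.mem_smul_set_iff_inv_smul_mem₀ hR.ne']
  simp only [An, Set.mem_setOf_eq, norm_smul, norm_inv, Real.norm_of_nonneg hR.le]
  rw [inv_mul_eq_div, le_div_iff₀ hR, div_le_iff₀ hR]
  constructor <;> rintro ⟨a, b⟩ <;> constructor <;> linarith

lemma ball_fin {q : ℝ} (hq1 : 1 ≤ q) (hq2 : q < 3 / 2) :
    ∫⁻ x in Metric.ball (0 : E) 1, ‖dK x‖ₑ ^ q < ∞ := by
  have h : IntegrableOn (fun x : E => ‖dK x‖ ^ q) (Metric.ball 0 1) := by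
    refine integrableOn_ball_of_norm_le_rpow (C := 1) (α := 2 * q) (by simp) ?_ ?_ ?_
    · simp; linarith
    · refine Eventually.of_forall fun x => ?_
      rw [Real.norm_of_nonneg (by positivity), dK_norm, one_mul, Real.inv_rpow (by positivity),
        Real.rpow_neg (norm_nonneg _), Real.rpow_mul (norm_nonneg _)]
      simp
    · exact (dK_meas.norm.pow_const q).aestronglyMeasurable
  have h2 := h.2
  unfold HasFiniteIntegral at h2
  refine lt_of_le_of_lt (le_of_eq ?_) h2
  refine lintegral_congr fun x => ?_
  rw [Real.enorm_rpow_of_nonneg (norm_nonneg _) (by linarith), enorm_norm]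

/-- The rescaled kernel difference integral. -/
def Ph (q : ℝ) (z : E) : ℝ≥0∞ := ∫⁻ x in An 1, ‖dK (x - z) - dK x‖ₑ ^ q

lemma Ph_bdd {q : ℝ} (hq1 : 1 ≤ q) (hq2 : q < 3 / 2) :
    ∃ C : ℝ≥0∞, C < ∞ ∧ ∀ z, Ph q z ≤ C := by
  set J : E → ℝ≥0∞ := (Metric.ball (0 : E) 1).indicator (fun x => ‖dK x‖ₑ ^ q) with hJ
  have hJm : Measurable J :=
    (dK_meas.enorm.pow_const q).indicator Metric.isOpen_ball.measurableSet
  have hJi : ∫⁻ x, J x < ∞ := by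
    rw [hJ, lintegral_indicator Metric.isOpen_ball.measurableSet]
    exact ball_fin hq1 hq2
  set c : ℝ≥0∞ := 1 + (ENNReal.ofReal (((1 / 8 : ℝ) ^ 2)⁻¹)) ^ q with hc
  have hcf : c < ∞ := by
    rw [hc]
    exact ENNReal.add_lt_top.2 ⟨ENNReal.one_lt_top,
      ENNReal.rpow_lt_top_of_nonneg (by linarith) ENNReal.ofReal_ne_top⟩
  have h2f : (2 : ℝ≥0∞) ^ (q - 1) < ∞ :=
    ENNReal.rpow_lt_top_of_nonneg (by linarith) (by simp)
  refine ⟨2 ^ (q - 1) * ((∫⁻ x, J x) + c * volume (An 1)), ?_, fun z => ?_⟩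
  · exact ENNReal.mul_lt_top h2f (ENNReal.add_lt_top.2 ⟨hJi, ENNReal.mul_lt_top hcf (An_vol 1)⟩)
  · have hpt : ∀ x ∈ An 1, ‖dK (x - z) - dK x‖ₑ ^ q ≤ 2 ^ (q - 1) * (J (x - z) + c) := by
      intro x hx
      have h1 : ‖dK (x - z)‖ₑ ^ q ≤ J (x - z) + 1 := by
        by_cases hb : x - z ∈ Metric.ball (0 : E) 1
        · rw [hJ, Set.indicator_of_mem hb]
          exact le_self_add
        · have : (1 : ℝ) ≤ ‖x - z‖ := by simpa using hb
          have h3 := dK_enorm_le one_pos this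
          refine le_trans ?_ le_add_self
          refine ENNReal.rpow_le_one ?_ (by linarith)
          simpa using h3
      have h2 : ‖dK x‖ₑ ^ q ≤ (ENNReal.ofReal (((1 / 8 : ℝ) ^ 2)⁻¹)) ^ q :=
        ENNReal.rpow_le_rpow (dK_enorm_le (by norm_num) hx.1) (by linarith)
      calc ‖dK (x - z) - dK x‖ₑ ^ q ≤ (‖dK (x - z)‖ₑ + ‖dK x‖ₑ) ^ q :=
            ENNReal.rpow_le_rpow enorm_sub_le (by linarith)
        _ ≤ 2 ^ (q - 1) * (‖dK (x - z)‖ₑ ^ q + ‖dK x‖ₑ ^ q) :=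
            ENNReal.rpow_add_le_mul_rpow_add_rpow _ _ hq1
        _ ≤ 2 ^ (q - 1) * (J (x - z) + c) := by
            rw [hc, ← add_assoc]
            gcongr
    calc Ph q z ≤ ∫⁻ x in An 1, 2 ^ (q - 1) * (J (x - z) + c) :=
          setLIntegral_mono' (An_meas 1) hpt
      _ = 2 ^ (q - 1) * ((∫⁻ x in An 1, J (x - z)) + c * volume (An 1)) := by
          rw [lintegral_const_mul' _ _ h2f.ne, lintegral_add_right _ measurable_const,
            setLIntegral_const]
      _ ≤ _ := by
          refine mul_le_mul_right (add_le_add_left ?_ _) _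
          calc ∫⁻ x in An 1, J (x - z) ≤ ∫⁻ x, J (x - z) := setLIntegral_le_lintegral _ _
            _ = ∫⁻ x, J x := lintegral_sub_right_eq_self J z

lemma Ph_lim {q : ℝ} (hq1 : 1 ≤ q) : Tendsto (Ph q) (𝓝 0) (𝓝 0) := by
  have key : Tendsto (fun z => ∫⁻ x in An 1, ‖dK (x - z) - dK x‖ₑ ^ q) (𝓝 (0 : E))
      (𝓝 (∫⁻ x in An 1, (fun _ => 0) x)) := by
    refine tendsto_lintegral_filter_of_dominated_convergence
      (fun _ => (ENNReal.ofReal (((1 / 16 : ℝ) ^ 2)⁻¹) + ENNReal.ofReal (((1 / 8 : ℝ) ^ 2)⁻¹)) ^ q)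
      ?_ ?_ ?_ ?_
    · refine Eventually.of_forall fun z => ?_
      exact (((dK_meas.comp (measurable_id.sub_const z)).sub dK_meas).enorm).pow_const q
    · filter_upwards [Metric.ball_mem_nhds (0 : E) (by norm_num : (0 : ℝ) < 1 / 16)] with z hz
      filter_upwards [ae_restrict_mem (An_meas 1)] with x hx
      have hz' : ‖z‖ < 1 / 16 := by simpa using hz
      have hx1 := hx.1
      refine ENNReal.rpow_le_rpow (enorm_sub_le.trans ?_) (by linarith)
      refine add_le_add (dK_enorm_le (by norm_num) ?_) (dK_enorm_le (by norm_num) hx1)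
      have := norm_sub_norm_le x z
      linarith
    · rw [setLIntegral_const]
      refine (ENNReal.mul_lt_top (ENNReal.rpow_lt_top_of_nonneg (by linarith) ?_) (An_vol 1)).ne
      simp
    · filter_upwards [ae_restrict_mem (An_meas 1)] with x hx
      have hx0 : x ≠ 0 := by
        rintro rfl
        have := hx.1
        norm_num at this
      have h1 : Tendsto (fun z : E => x - z) (𝓝 0) (𝓝 x) := by
        have : Continuous fun z : E => x - z := by fun_prop
        simpa using this.tendsto 0
      have h2 := ((dK_contAt hx0).tendsto.comp h1).sub_const (dK x)
      have h3 := (h2.enorm).ennrpow_const q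
      simpa [ENNReal.zero_rpow_of_pos (by linarith : 0 < q), Function.comp_def] using h3
  rw [lintegral_zero] at key
  exact key

lemma pt_bound (X : E → E) (hX : Integrable X) (x : E) :
    ‖(1 / (4 * π)) * (∫ y, ⟪dK (x - y), X y⟫) - ⟪x, (1 / (4 * π)) • ∫ y, X y⟫ / ‖x‖ ^ 3‖ₑ
      ≤ ∫⁻ y, ‖dK (x - y) - dK x‖ₑ * ‖X y‖ₑ := by
  have hle : ∀ y, ‖(⟪dK (x - y) - dK x, X y⟫ : ℝ)‖ₑ ≤ ‖dK (x - y) - dK x‖ₑ * ‖X y‖ₑ := by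
    intro y
    rw [← ofReal_norm, ← ofReal_norm, ← ofReal_norm,
      ← ENNReal.ofReal_mul (norm_nonneg _)]
    exact ENNReal.ofReal_le_ofReal (norm_inner_le_norm _ _)
  have hm : AEStronglyMeasurable (fun y => (⟪dK (x - y) - dK x, X y⟫ : ℝ)) := by
    refine AEStronglyMeasurable.inner ?_ hX.1
    exact ((dK_meas.comp (measurable_id.const_sub x)).sub_const _).aestronglyMeasurable
  have hc : Integrable (fun y => (⟪dK x, X y⟫ : ℝ)) := hX.const_inner _
  by_cases hi : Integrable (fun y => (⟪dK (x - y) - dK x, X y⟫ : ℝ))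
  · have hi2 : Integrable (fun y => (⟪dK (x - y), X y⟫ : ℝ)) := by
      have := hi.add hc
      refine this.congr (Eventually.of_forall fun y => ?_)
      simp [inner_sub_left]
    have e1 : (1 / (4 * π)) * (∫ y, ⟪dK (x - y), X y⟫) - ⟪x, (1 / (4 * π)) • ∫ y, X y⟫ / ‖x‖ ^ 3
        = (1 / (4 * π)) * ∫ y, (⟪dK (x - y) - dK x, X y⟫ : ℝ) := by
      simp_rw [inner_sub_left]
      rw [integral_sub hi2 hc, integral_inner hX, dK, inner_smul_right, real_inner_smul_left]
      ring
    rw [e1, enorm_mul]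
    have h4 : ‖1 / (4 * π)‖ₑ ≤ 1 := by
      rw [← ofReal_norm, Real.norm_of_nonneg (by positivity)]
      rw [ENNReal.ofReal_le_one, div_le_one (by positivity)]
      linarith [Real.pi_gt_three]
    calc _ ≤ 1 * ∫⁻ y, ‖(⟪dK (x - y) - dK x, X y⟫ : ℝ)‖ₑ :=
          mul_le_mul' h4 (enorm_integral_le_lintegral_enorm _)
      _ ≤ _ := by
          rw [one_mul]
          exact lintegral_mono hle
  · have : ∫⁻ y, ‖(⟪dK (x - y) - dK x, X y⟫ : ℝ)‖ₑ = ∞ := by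
      by_contra hne
      exact hi ⟨hm, lt_top_iff_ne_top.2 hne⟩
    have h2 := lintegral_mono (μ := volume) hle
    rw [this, top_le_iff] at h2
    rw [h2]
    exact le_top

/-- Scale-invariant annular `L^q` estimate: `w` is asymptotic to the dipole
`⟨x, X̄⟩/|x|³` at infinity, where `X̄ = (1/4π)∫X` and
`w(x) = (1/4π)∫⟨(x-y)/|x-y|³, X(y)⟩ dy`. -/
theorem annulus_dipole_estimate
    (X : E → E) (hX : Integrable X)
    (w : E → ℝ)
    (hw : ∀ x, w x = (1 / (4 * π)) * ∫ y, ⟪(‖x - y‖ ^ 3)⁻¹ • (x - y), X y⟫)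
    (Xbar : E) (hXbar : Xbar = (1 / (4 * π)) • ∫ y, X y)
    (q : ℝ) (hq1 : 1 ≤ q) (hq2 : q < 3 / 2) :
    Tendsto (fun R : ℝ =>
        (volume (An R)).toReal⁻¹ *
          ∫ x in An R, |R ^ 2 * (w x - ⟪x, Xbar⟫ / ‖x‖ ^ 3)| ^ q)
      atTop (nhds 0) := by
  have hq0 : 0 ≤ q := by linarith
  set ν : Measure E := volume.withDensity (fun y => ‖X y‖ₑ) with hν
  have hνfin : IsFiniteMeasure ν := isFiniteMeasure_withDensity hX.2.ne
  set h : ℝ → E → ℝ := fun R x => R ^ 2 * (w x - ⟪x, Xbar⟫ / ‖x‖ ^ 3) with hh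
  have hmeas : ∀ R : ℝ, Measurable (fun p : E × E => ‖dK (p.1 - R⁻¹ • p.2) - dK p.1‖ₑ ^ q) := by
    intro R
    refine Measurable.pow_const (Measurable.enorm (Measurable.sub ?_ ?_)) q
    · exact dK_meas.comp (by fun_prop)
    · exact dK_meas.comp measurable_fst
  -- pointwise bound after rescaling
  have hpt : ∀ R : ℝ, 0 < R → ∀ x, ‖|h R (R • x)| ^ q‖ₑ ≤
      ν Set.univ ^ (q - 1) * ∫⁻ y, ‖dK (x - R⁻¹ • y) - dK x‖ₑ ^ q ∂ν := by
    intro R hR x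
    have hm : Measurable (fun y => dK (x - R⁻¹ • y) - dK x) :=
      (dK_meas.comp (by fun_prop)).sub_const _
    have b1 : ‖h R (R • x)‖ₑ ≤ ∫⁻ y, ‖dK (x - R⁻¹ • y) - dK x‖ₑ ∂ν := by
      rw [hν, lintegral_withDensity_eq_lintegral_mul₀' hX.1.enorm hm.enorm.aemeasurable]
      have := pt_bound X hX (R • x)
      have hwx : w (R • x) - ⟪R • x, Xbar⟫ / ‖R • x‖ ^ 3 =
          (1 / (4 * π)) * (∫ y, ⟪dK (R • x - y), X y⟫)
            - ⟪R • x, (1 / (4 * π)) • ∫ y, X y⟫ / ‖R • x‖ ^ 3 := by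
        rw [hw, hXbar]
        rfl
      rw [← hwx] at this
      simp only [hh]
      rw [enorm_mul]
      refine (mul_le_mul_right this _).trans ?_
      rw [← lintegral_const_mul' _ _ enorm_ne_top]
      refine le_of_eq (lintegral_congr fun y => ?_)
      rw [Pi.mul_apply, ← mul_assoc, mul_comm, ← enorm_smul, smul_sub, dK_smul hR]
      have : R • x - y = R • (x - R⁻¹ • y) := by
        rw [smul_sub, smul_smul, mul_inv_cancel₀ hR.ne', one_smul]
      rw [this, dK_smul hR]
    have b2 := eLpNorm'_le_eLpNorm'_mul_rpow_measure_univ (μ := ν) one_pos hq1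
      (f := fun y => dK (x - R⁻¹ • y) - dK x) hm.aestronglyMeasurable
    simp only [eLpNorm', ENNReal.rpow_one, div_one] at b2
    rw [Real.enorm_rpow_of_nonneg (abs_nonneg _) hq0, Real.enorm_abs]
    calc ‖h R (R • x)‖ₑ ^ q ≤ _ := ENNReal.rpow_le_rpow (b1.trans b2) hq0
      _ = _ := by
        rw [ENNReal.mul_rpow_of_nonneg _ _ hq0, ← ENNReal.rpow_mul, ← ENNReal.rpow_mul, mul_comm,
          one_div_mul_cancel (by linarith), ENNReal.rpow_one]
        congr 2
        field_simp
  -- the scaled integral tends to zero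
  have hlim : Tendsto (fun R : ℝ => ∫⁻ y, Ph q (R⁻¹ • y) ∂ν) atTop (𝓝 0) := by
    obtain ⟨C, hC, hCb⟩ := Ph_bdd hq1 hq2
    have : Tendsto (fun R : ℝ => ∫⁻ y, Ph q (R⁻¹ • y) ∂ν) atTop (𝓝 (∫⁻ y, (fun _ => 0) y ∂ν)) := by
      refine tendsto_lintegral_filter_of_dominated_convergence (fun _ => C) ?_ ?_ ?_ ?_
      · refine Eventually.of_forall fun R => ?_
        exact (hmeas R).lintegral_prod_left'
      · exact Eventually.of_forall fun R => Eventually.of_forall fun y => hCb _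
      · rw [lintegral_const]
        exact (ENNReal.mul_lt_top hC (measure_lt_top _ _)).ne
      · refine Eventually.of_forall fun y => ?_
        refine (Ph_lim hq1).comp ?_
        have := (tendsto_inv_atTop_zero (𝕜 := ℝ)).smul_const y
        simpa using this
    simpa using this
  have hlim2 : Tendsto (fun R : ℝ => ∫ x in An 1, |h R (R • x)| ^ q) atTop (𝓝 0) := by
    have hA : ν Set.univ ^ (q - 1) ≠ ∞ :=
      (ENNReal.rpow_lt_top_of_nonneg (by linarith) (measure_ne_top _ _)).ne
    have hl3 := ENNReal.Tendsto.const_mul hlim (Or.inr hA)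
    rw [mul_zero] at hl3
    have hl4 : Tendsto (fun R : ℝ => ‖∫ x in An 1, |h R (R • x)| ^ q‖ₑ) atTop (𝓝 0) := by
      refine tendsto_of_tendsto_of_tendsto_of_le_of_le' tendsto_const_nhds hl3
        (Eventually.of_forall fun _ => zero_le) ?_
      filter_upwards [eventually_gt_atTop (0 : ℝ)] with R hR
      refine (enorm_integral_le_lintegral_enorm _).trans ?_
      refine (lintegral_mono (hpt R hR)).trans ?_
      rw [lintegral_const_mul' _ _ hA]
      refine le_of_eq ?_
      congr 1
      exact lintegral_lintegral_swap (hmeas R).aemeasurable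
    rw [tendsto_zero_iff_norm_tendsto_zero]
    have := (ENNReal.tendsto_toReal ENNReal.zero_ne_top).comp hl4
    simpa [Function.comp_def] using this
  have hfin := hlim2.const_mul (volume (An 1)).toReal⁻¹
  rw [mul_zero] at hfin
  refine hfin.congr' ?_
  filter_upwards [eventually_gt_atTop (0 : ℝ)] with R hR
  rw [Measure.setIntegral_comp_smul_of_pos volume (fun x => |h R x| ^ q) (An 1) hR, ← An_smul hR]
  have hv : (volume (An R)).toReal = R ^ 3 * (volume (An 1)).toReal := by
    rw [An_smul hR, Measure.addHaar_smul, ENNReal.toReal_mul, ENNReal.toReal_ofReal (abs_nonneg _),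
      abs_of_pos (by positivity)]
    simp
  rw [hv, mul_inv, smul_eq_mul]
  simp only [finrank_euclideanSpace, Fintype.card_fin]
  ring
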